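/- arXiv:1407.5298 — 5 statements merged into one kernel-verified Lean document; each statement's English description precedes it below -/
import Mathlib

section
/- Let L be a PCMC LP and σ > 0. If the LP L(1 + 1/σ) (obtained from L by replacing the covering right-hand side d with (1 + 1/σ)·d) is feasible, then L is (ε,σ)-stable for every ε ∈ (0,1], i.e., OPT(L(1−ε)) ≤ (1 + σε)·OPT(L) for every ε ∈ (0,1]. -/
open Finset

noncomputable section

/-- A packing/covering multiple-choice LP with `n` column-blocks, `k` choices per block,
`m_p` packing constraints and `m_c` covering constraints. -/
structure PCMC (n k mp mc : ℕ) where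
  pi : Fin n → Fin k → ℝ
  A : Fin n → Fin mp → Fin k → ℝ
  C : Fin n → Fin mc → Fin k → ℝ
  b : Fin mp → ℝ
  d : Fin mc → ℝ

namespace PCMC

variable {n k mp mc : ℕ}

/-- all the data is nonnegative (right-hand sides positive). -/
def NonnegData (L : PCMC n k mp mc) : Prop :=
  (∀ t j, 0 ≤ L.pi t j) ∧ (∀ t i j, 0 ≤ L.A t i j) ∧ (∀ t i j, 0 ≤ L.C t i j) ∧
  (∀ i, 0 < L.b i) ∧ (∀ i, 0 < L.d i)

end PCMC

/-- membership in the full simplex `▽^k = {x ∈ [0,1]^k : Σ_j x_j ≤ 1}`. -/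
def inFullSimplex {k : ℕ} (x : Fin k → ℝ) : Prop := (∀ j, 0 ≤ x j) ∧ ∑ j, x j ≤ 1

namespace PCMC

variable {n k mp mc : ℕ}

/-- feasibility of a solution of a PCMC LP. -/
def Feasible (L : PCMC n k mp mc) (x : Fin n → Fin k → ℝ) : Prop :=
  (∀ t, inFullSimplex (x t)) ∧
  (∀ i, ∑ t, ∑ j, L.A t i j * x t j ≤ L.b i) ∧
  (∀ i, L.d i ≤ ∑ t, ∑ j, L.C t i j * x t j)

/-- value of a solution. -/
def value (L : PCMC n k mp mc) (x : Fin n → Fin k → ℝ) : ℝ := ∑ t, ∑ j, L.pi t j * x t j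

/-- optimal value of a PCMC LP (the optimal value of an infeasible LP is `0 = sSup ∅`). -/
def opt (L : PCMC n k mp mc) : ℝ := sSup {v : ℝ | ∃ x, L.Feasible x ∧ v = L.value x}

/-- `L(θ)`: the LP obtained by replacing the covering right-hand side `d` by `θ·d`. -/
def scaleCover (L : PCMC n k mp mc) (θ : ℝ) : PCMC n k mp mc :=
  { L with d := fun i => θ * L.d i }

/-- `(ε,σ)`-stability: `OPT(L(1-ε)) ≤ (1+σε)·OPT(L)`. -/
def Stable (L : PCMC n k mp mc) (ε σ : ℝ) : Prop :=
  (L.scaleCover (1 - ε)).opt ≤ (1 + σ * ε) * L.opt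

/-- feasibility of a solution for the restricted LP `L^I(θ)`: only the columns in `I`
are kept, the right-hand sides are scaled by `|I|/n`, and additionally the covering
right-hand side is multiplied by `θ`. -/
def RestFeasible (L : PCMC n k mp mc) (I : Finset (Fin n)) (θ : ℝ)
    (x : Fin n → Fin k → ℝ) : Prop :=
  (∀ t, inFullSimplex (x t)) ∧
  (∀ i, ∑ t ∈ I, ∑ j, L.A t i j * x t j ≤ (I.card : ℝ) / n * L.b i) ∧
  (∀ i, θ * ((I.card : ℝ) / n * L.d i) ≤ ∑ t ∈ I, ∑ j, L.C t i j * x t j)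

/-- value of a solution of the restricted LP `L^I`. -/
def restValue (L : PCMC n k mp mc) (I : Finset (Fin n)) (x : Fin n → Fin k → ℝ) : ℝ :=
  ∑ t ∈ I, ∑ j, L.pi t j * x t j

/-- optimal value of the restricted LP `L^I(θ)` (`0` if infeasible). -/
def restOpt (L : PCMC n k mp mc) (I : Finset (Fin n)) (θ : ℝ) : ℝ :=
  sSup {v : ℝ | ∃ x, L.RestFeasible I θ x ∧ v = L.restValue I x}

end PCMC

/-- fraction of the `binomial(n,s)` subsets of size `s` satisfying `P`. -/
def subsetFrac (n s : ℕ) (P : Finset (Fin n) → Prop) : ℝ :=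
  (Nat.card {I : Finset (Fin n) // I.card = s ∧ P I} : ℝ) /
    (Nat.card {I : Finset (Fin n) // I.card = s} : ℝ)

theorem lin_aux {n k : ℕ} (w x y : Fin n → Fin k → ℝ) (a c : ℝ) :
    ∑ t, ∑ j, w t j * (a * y t j + c * x t j) =
      a * (∑ t, ∑ j, w t j * y t j) + c * (∑ t, ∑ j, w t j * x t j) := by
  simp only [Finset.mul_sum, ← Finset.sum_add_distrib]
  refine Finset.sum_congr rfl fun t _ => Finset.sum_congr rfl fun j _ => ?_
  ring

/-- sufficient condition for stability: if `L(1 + 1/σ)` is feasible,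
then `L` is `(ε,σ)`-stable for every `ε ∈ (0,1]`. -/
theorem stmt5 {n k mp mc : ℕ} (L : PCMC n k mp mc) (hL : L.NonnegData)
    (σ : ℝ) (hσ : 0 < σ)
    (hfeas : ∃ x, (L.scaleCover (1 + 1 / σ)).Feasible x) :
    ∀ ε : ℝ, 0 < ε → ε ≤ 1 → L.Stable ε σ := by
  intro ε hε hε1
  obtain ⟨x, hx1, hx2, hx3⟩ := hfeas
  obtain ⟨hpi, hA, hC, hb, hd⟩ := hL
  have hs : 0 < 1 + σ * ε := by positivity
  have hval : ∀ x : Fin n → Fin k → ℝ, (∀ t, inFullSimplex (x t)) → 0 ≤ L.value x := by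
    intro x hx
    exact Finset.sum_nonneg fun t _ => Finset.sum_nonneg fun j _ =>
      mul_nonneg (hpi t j) ((hx t).1 j)
  have hbdd : BddAbove {v : ℝ | ∃ x, L.Feasible x ∧ v = L.value x} := by
    refine ⟨∑ t, ∑ j, L.pi t j, ?_⟩
    rintro v ⟨z, hz, rfl⟩
    refine Finset.sum_le_sum fun t _ => Finset.sum_le_sum fun j _ => ?_
    have h1 : z t j ≤ 1 :=
      (Finset.single_le_sum (fun i _ => (hz.1 t).1 i) (Finset.mem_univ j)).trans (hz.1 t).2
    exact mul_le_of_le_one_right (hpi t j) h1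
  have hopt : 0 ≤ L.opt := by
    refine Real.sSup_nonneg ?_
    rintro v ⟨z, hz, rfl⟩
    exact hval z hz.1
  refine Real.sSup_le ?_ (mul_nonneg hs.le hopt)
  rintro v ⟨y, ⟨hy1, hy2, hy3⟩, rfl⟩
  change L.value y ≤ _
  simp only [PCMC.scaleCover] at hx2 hx3 hy2 hy3
  obtain ⟨a, ha⟩ : ∃ a, a = 1 / (1 + σ * ε) := ⟨_, rfl⟩
  have ha0 : 0 < a := by rw [ha]; positivity
  have ha1 : (1 + σ * ε) * a = 1 := by rw [ha]; field_simp
  have hc0 : 0 ≤ a * (σ * ε) := by positivity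
  have hac : a + a * (σ * ε) = 1 := by linarith
  have key : L.Feasible (fun t j => a * y t j + a * (σ * ε) * x t j) := by
    refine ⟨fun t => ⟨fun j => ?_, ?_⟩, fun i => ?_, fun i => ?_⟩
    · exact add_nonneg (mul_nonneg ha0.le ((hy1 t).1 j)) (mul_nonneg hc0 ((hx1 t).1 j))
    · rw [Finset.sum_add_distrib, ← Finset.mul_sum, ← Finset.mul_sum]
      have h1 := mul_le_mul_of_nonneg_left (hy1 t).2 ha0.le
      have h2 := mul_le_mul_of_nonneg_left (hx1 t).2 hc0
      linarith
    · rw [lin_aux (fun t j => L.A t i j)]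
      have h1 := mul_le_mul_of_nonneg_left (hy2 i) ha0.le
      have h2 := mul_le_mul_of_nonneg_left (hx2 i) hc0
      have h3 : a * L.b i + a * (σ * ε) * L.b i = L.b i := by rw [← add_mul, hac, one_mul]
      linarith
    · rw [lin_aux (fun t j => L.C t i j)]
      have h1 := mul_le_mul_of_nonneg_left (hy3 i) ha0.le
      have h2 := mul_le_mul_of_nonneg_left (hx3 i) hc0
      have h3 : a * ((1 - ε) * L.d i) + a * (σ * ε) * ((1 + 1 / σ) * L.d i) = L.d i := by
        have h4 : a * ((1 - ε) * L.d i) + a * (σ * ε) * ((1 + 1 / σ) * L.d i)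
            = ((1 + σ * ε) * a) * L.d i := by
          field_simp
          ring
        rw [h4, ha1, one_mul]
      linarith
  have hle : L.value (fun t j => a * y t j + a * (σ * ε) * x t j) ≤ L.opt :=
    le_csSup hbdd ⟨_, key, rfl⟩
  have heq : L.value (fun t j => a * y t j + a * (σ * ε) * x t j)
      = a * L.value y + a * (σ * ε) * L.value x := lin_aux L.pi x y _ _
  have h5 : a * L.value y ≤ L.opt := by
    have := mul_nonneg hc0 (hval x hx1)
    linarith
  calc L.value y = (1 + σ * ε) * (a * L.value y) := by rw [← mul_assoc, ha1, one_mul]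
    _ ≤ _ := mul_le_mul_of_nonneg_left h5 hs.le

end
end

section
/- Let L be a feasible PCMC LP that is (ε,σ)-stable for some ε ∈ (0,1) and σ ≥ 0. Then for every ε' with ε ≤ ε' < 1, L is (ε',σ)-stable; that is, OPT(L(1−ε')) ≤ (1 + σε')·OPT(L). -/
open Finset

noncomputable section

theorem stmt6_bdd {n k mp mc : ℕ} (L : PCMC n k mp mc) (hpi : ∀ t j, 0 ≤ L.pi t j) :
    BddAbove {v : ℝ | ∃ x, L.Feasible x ∧ v = L.value x} := by
  refine ⟨∑ t, ∑ j, L.pi t j, ?_⟩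
  rintro v ⟨x, hx, rfl⟩
  unfold PCMC.value
  refine Finset.sum_le_sum fun t _ => Finset.sum_le_sum fun j _ => ?_
  have h1 : x t j ≤ 1 :=
    (Finset.single_le_sum (fun i _ => (hx.1 t).1 i) (Finset.mem_univ j)).trans (hx.1 t).2
  exact mul_le_of_le_one_right (hpi t j) h1

theorem stmt6_lin {n k : ℕ} (c x y : Fin n → Fin k → ℝ) (a b : ℝ) :
    ∑ t, ∑ j, c t j * (a * y t j + b * x t j)
      = a * ∑ t, ∑ j, c t j * y t j + b * ∑ t, ∑ j, c t j * x t j := by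
  simp only [Finset.mul_sum, ← Finset.sum_add_distrib]
  refine Finset.sum_congr rfl fun t _ => Finset.sum_congr rfl fun j _ => ?_
  ring

/-- monotonicity of stability: an `(ε,σ)`-stable feasible PCMC LP is
`(ε',σ)`-stable for every `ε' ∈ [ε,1)`. -/
theorem stmt6 {n k mp mc : ℕ} (L : PCMC n k mp mc) (hL : L.NonnegData)
    (hfeas : ∃ x, L.Feasible x)
    (ε σ : ℝ) (hε0 : 0 < ε) (hε1 : ε < 1) (hσ : 0 ≤ σ)
    (hstable : L.Stable ε σ) :
    ∀ ε' : ℝ, ε ≤ ε' → ε' < 1 → L.Stable ε' σ := by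
  intro ε' h1 h2
  have hε' : 0 < ε' := hε0.trans_le h1
  obtain ⟨hpi, -, -, -, hd⟩ := hL
  unfold PCMC.Stable at hstable ⊢
  have hb := stmt6_bdd L hpi
  have hb2 := stmt6_bdd (L.scaleCover (1 - ε)) hpi
  obtain ⟨x0, hx0⟩ := hfeas
  obtain ⟨l, hl⟩ : ∃ l, l = ε / ε' := ⟨_, rfl⟩
  have hl0 : 0 < l := hl ▸ div_pos hε0 hε'
  have hl1 : l ≤ 1 := by rw [hl]; exact (div_le_one hε').2 h1
  have hle : l * ε' = ε := by rw [hl]; field_simp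
  have key : ∀ x y, L.Feasible x → (L.scaleCover (1 - ε')).Feasible y →
      l * L.value y + (1 - l) * L.value x ≤ (1 + σ * ε) * L.opt := by
    intro x y hx hy
    refine le_trans ?_ hstable
    refine le_csSup hb2 ⟨fun t j => l * y t j + (1 - l) * x t j, ⟨?_, ?_, ?_⟩, ?_⟩
    · intro t
      refine ⟨fun j => ?_, ?_⟩
      · exact add_nonneg (mul_nonneg hl0.le ((hy.1 t).1 j))
          (mul_nonneg (by linarith) ((hx.1 t).1 j))
      · rw [Finset.sum_add_distrib, ← Finset.mul_sum, ← Finset.mul_sum]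
        have e1 := mul_le_mul_of_nonneg_left (hy.1 t).2 hl0.le
        have e2 := mul_le_mul_of_nonneg_left (hx.1 t).2 (sub_nonneg.2 hl1)
        linarith
    · intro i
      rw [stmt6_lin (fun t j => (L.scaleCover (1 - ε)).A t i j)]
      have e1 := mul_le_mul_of_nonneg_left (hy.2.1 i) hl0.le
      have e2 := mul_le_mul_of_nonneg_left (hx.2.1 i) (sub_nonneg.2 hl1)
      simp only [PCMC.scaleCover] at e1 e2 ⊢
      linarith
    · intro i
      rw [stmt6_lin (fun t j => (L.scaleCover (1 - ε)).C t i j)]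
      have e1 := mul_le_mul_of_nonneg_left (hy.2.2 i) hl0.le
      have e2 := mul_le_mul_of_nonneg_left (hx.2.2 i) (sub_nonneg.2 hl1)
      simp only [PCMC.scaleCover] at e1 e2 ⊢
      have e3 : (1 - ε) * L.d i = l * ((1 - ε') * L.d i) + (1 - l) * L.d i := by
        rw [← hle]; ring
      linarith
    · exact (stmt6_lin L.pi x y l (1 - l)).symm
  have key2 : ∀ y, (L.scaleCover (1 - ε')).Feasible y →
      L.value y ≤ (1 + σ * ε') * L.opt := by
    intro y hy
    have h3 : l * L.value y + (1 - l) * L.opt ≤ (1 + σ * ε) * L.opt := by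
      refine le_of_forall_pos_le_add fun δ hδ => ?_
      obtain ⟨v, ⟨x, hx, rfl⟩, hv⟩ := exists_lt_of_lt_csSup
        (s := {v : ℝ | ∃ x, L.Feasible x ∧ v = L.value x}) ⟨_, x0, hx0, rfl⟩
        (show L.opt - δ < sSup _ from sub_lt_self _ hδ)
      have e1 := key x y hx hy
      have e2 := mul_le_mul_of_nonneg_left hv.le (sub_nonneg.2 hl1)
      have e3 : 0 ≤ l * δ := by positivity
      linarith
    have h4 : l * L.value y ≤ l * ((1 + σ * ε') * L.opt) := by
      have : l * ((1 + σ * ε') * L.opt) = (1 + σ * ε) * L.opt - (1 - l) * L.opt := by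
        rw [← hle]; ring
      linarith
    exact le_of_mul_le_mul_left h4 hl0
  refine csSup_le ⟨_, x0, ⟨hx0.1, hx0.2.1, fun i => ?_⟩, rfl⟩ ?_
  · refine le_trans ?_ (hx0.2.2 i)
    have := mul_pos hε' (hd i)
    simp only [PCMC.scaleCover]
    linarith
  · rintro v ⟨y, hy, rfl⟩
    exact key2 y hy

end
end

section
/- Let L be a feasible PCMC LP that is (ε,σ)-stable for some ε ∈ (0,1) and σ ≥ 0. Suppose (α̃, β̃, γ̃) with α̃ ∈ ℝ_{≥0}^{m_p}, β̃ ∈ ℝ_{≥0}^{m_c}, γ̃ ∈ ℝ_{≥0}^n is an optimal solution of the dual D(1−ε) of L(1−ε), i.e., (α̃, β̃, γ̃) satisfies ⟨A^t_{·,j}, α̃⟩ − ⟨C^t_{·,j}, β̃⟩ + γ̃_t ≥ π^t_j for all j ∈ [k] and t ∈ [n], and its objective value ⟨α̃, b⟩ − (1−ε)·⟨β̃, d⟩ + Σ_{t=1}^n γ̃_t equals OPT(L(1−ε)). Then ⟨β̃, d⟩ ≤ σ·OPT(L). -/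
open Finset

noncomputable section

/-- an optimal dual of `L(1-ε)` has small covering part: if
`(α̃, β̃, γ̃)` is dual feasible and its dual objective value equals `OPT(L(1-ε))`,
then `⟨β̃, d⟩ ≤ σ·OPT(L)`. -/
theorem stmt7 {n k mp mc : ℕ} (L : PCMC n k mp mc) (hL : L.NonnegData)
    (hfeas : ∃ x, L.Feasible x)
    (ε σ : ℝ) (hε0 : 0 < ε) (hε1 : ε < 1) (hσ : 0 ≤ σ)
    (hstable : L.Stable ε σ)
    (a : Fin mp → ℝ) (β : Fin mc → ℝ) (g : Fin n → ℝ)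
    (ha : ∀ i, 0 ≤ a i) (hβ : ∀ i, 0 ≤ β i) (hg : ∀ t, 0 ≤ g t)
    (hdualFeas : ∀ (t : Fin n) (j : Fin k),
      L.pi t j ≤ (∑ i, L.A t i j * a i) - (∑ i, L.C t i j * β i) + g t)
    (hdualOpt : (∑ i, a i * L.b i) - (1 - ε) * (∑ i, β i * L.d i) + ∑ t, g t =
      (L.scaleCover (1 - ε)).opt) :
    ∑ i, β i * L.d i ≤ σ * L.opt := by
  obtain ⟨hpi, hA, hC, hb, hd⟩ := hL
  have key : L.opt ≤ (∑ i, a i * L.b i) - (∑ i, β i * L.d i) + ∑ t, g t := by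
    unfold PCMC.opt
    apply csSup_le
    · obtain ⟨x, hx⟩ := hfeas
      exact ⟨_, x, hx, rfl⟩
    · rintro v ⟨x, ⟨hs, hp, hc⟩, rfl⟩
      have h1 : L.value x ≤ ∑ t, ∑ j,
          ((∑ i, L.A t i j * a i) - (∑ i, L.C t i j * β i) + g t) * x t j := by
        unfold PCMC.value
        exact Finset.sum_le_sum fun t _ => Finset.sum_le_sum fun j _ =>
          mul_le_mul_of_nonneg_right (hdualFeas t j) ((hs t).1 j)
      have swap : ∀ {m : ℕ} (M : Fin n → Fin m → Fin k → ℝ) (y : Fin m → ℝ),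
          ∑ t, ∑ j, (∑ i, M t i j * y i) * x t j
            = ∑ i, y i * ∑ t, ∑ j, M t i j * x t j := by
        intro m M y
        simp only [Finset.sum_mul, Finset.mul_sum]
        have : ∀ t : Fin n, ∑ j, ∑ i, M t i j * y i * x t j
            = ∑ i, ∑ j, y i * (M t i j * x t j) := by
          intro t
          rw [Finset.sum_comm]
          exact Finset.sum_congr rfl fun i _ => Finset.sum_congr rfl fun j _ => by ring
        simp only [this]
        rw [Finset.sum_comm]
      have h2 : ∑ t, ∑ j,
          ((∑ i, L.A t i j * a i) - (∑ i, L.C t i j * β i) + g t) * x t j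
          = (∑ i, a i * ∑ t, ∑ j, L.A t i j * x t j)
            - (∑ i, β i * ∑ t, ∑ j, L.C t i j * x t j) + ∑ t, g t * ∑ j, x t j := by
        rw [← swap, ← swap]
        simp only [add_mul, sub_mul, Finset.sum_add_distrib, Finset.sum_sub_distrib,
          Finset.mul_sum]
      have h3 : ∑ i, a i * ∑ t, ∑ j, L.A t i j * x t j ≤ ∑ i, a i * L.b i :=
        Finset.sum_le_sum fun i _ => mul_le_mul_of_nonneg_left (hp i) (ha i)
      have h4 : ∑ i, β i * L.d i ≤ ∑ i, β i * ∑ t, ∑ j, L.C t i j * x t j :=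
        Finset.sum_le_sum fun i _ => mul_le_mul_of_nonneg_left (hc i) (hβ i)
      have h5 : ∑ t, g t * ∑ j, x t j ≤ ∑ t, g t :=
        Finset.sum_le_sum fun t _ => mul_le_of_le_one_right (hg t) (hs t).2
      linarith
  unfold PCMC.Stable at hstable
  have : ε * ∑ i, β i * L.d i ≤ ε * (σ * L.opt) := by linarith
  exact le_of_mul_le_mul_left this hε0

end
end

section
/- Let ε, δ ∈ (0,1), let L be a PCMC LP with m = m_p + m_c ≥ 1 constraints, δ < m, and width at least 32·log(m/δ)/ε² (i.e., a^t_{ij} ≤ b_i·ε²/(32·log(m/δ)) and c^t_{ij} ≤ d_i·ε²/(32·log(m/δ)) for all entries). Let s be an integer with ε²·n ≤ s ≤ n and set ε' = ε·√(n/s). Let (x̄^t)_{t=1}^n be any feasible solution of L. Then the fraction of s-element subsets I ⊆ {1,…,n} for which the scaled restriction ((1 − ε'/2)·x̄^t)_{t∈I} is feasible for the restricted LP L^I(1−ε') is at least 1 − 2δ. -/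
open Finset

noncomputable section

lemma choose_ratio (n s j : ℕ) (hs : s ≤ n) (hj : j ≤ s) (hn : 0 < n) :
    (Nat.choose (n - j) (s - j) : ℝ) ≤ ((s : ℝ) / n) ^ j * (Nat.choose n s : ℝ) := by
  induction j with
  | zero => simp
  | succ j ih =>
    have ih := ih (by omega)
    obtain ⟨a, rfl⟩ : ∃ a, s = a + (j + 1) := ⟨s - (j+1), by omega⟩
    obtain ⟨b, rfl⟩ : ∃ b, n = b + (j + 1) := ⟨n - (j+1), by omega⟩
    have e1 : a + (j+1) - (j+1) = a := by omega
    have e2 : b + (j+1) - (j+1) = b := by omega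
    have e3 : a + (j+1) - j = a + 1 := by omega
    have e4 : b + (j+1) - j = b + 1 := by omega
    rw [e1, e2]
    rw [e3, e4] at ih
    have h := Nat.add_one_mul_choose_eq b a
    have h' : ((b : ℝ) + 1) * (b.choose a : ℝ) = ((b+1).choose (a+1) : ℝ) * ((a:ℝ) + 1) := by
      exact_mod_cast h
    have hab : (a : ℝ) ≤ b := by exact_mod_cast (by omega : a ≤ b)
    have hb : (0:ℝ) < b + 1 := by positivity
    have hr : ((a:ℝ) + 1) / (b + 1) ≤ ((a + (j+1) : ℕ) : ℝ) / ((b + (j + 1) : ℕ) : ℝ) := by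
      push_cast
      rw [div_le_div_iff₀ (by positivity) (by positivity)]
      have : (0:ℝ) ≤ j := by positivity
      nlinarith
    have : (b.choose a : ℝ) = ((a:ℝ) + 1) / (b + 1) * ((b+1).choose (a+1) : ℝ) := by
      field_simp; linarith
    rw [this, pow_succ']
    calc _ ≤ _ := mul_le_mul hr ih (by positivity) (by positivity)
      _ = _ := by ring

lemma card_super (n s : ℕ) (J : Finset (Fin n)) :
    (((powersetCard s (univ : Finset (Fin n))).filter (fun I => J ⊆ I)).card) 
      ≤ if J.card ≤ s then Nat.choose (n - J.card) (s - J.card) else 0 := by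
  split_ifs with h
  · rw [card_filter_powersetCard_subset J univ s (subset_univ _) h]; simp
  · rw [Nat.le_zero, card_eq_zero, filter_eq_empty_iff]
    intro I hI hJ
    rw [mem_powersetCard] at hI
    have := card_le_card hJ
    omega

lemma mgf_nonneg (n s : ℕ) (hs : s ≤ n) (hn : 0 < n) (g : Fin n → ℝ) (hg : ∀ t, 0 ≤ g t) :
    ∑ I ∈ powersetCard s (univ : Finset (Fin n)), ∏ t ∈ I, (1 + g t)
      ≤ (Nat.choose n s : ℝ) * ∏ t, (1 + (s : ℝ) / n * g t) := by
  have h1 : ∀ I : Finset (Fin n), ∏ t ∈ I, (1 + g t) = ∑ J : Finset (Fin n), 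
      if J ⊆ I then ∏ t ∈ J, g t else 0 := by
    intro I
    rw [prod_one_add, ← sum_filter]
    apply sum_congr _ (fun _ _ => rfl)
    ext J; simp
  simp_rw [h1]
  rw [sum_comm, prod_one_add, mul_sum]
  simp only [powerset_univ]
  apply sum_le_sum
  intro J _
  rw [← sum_filter, sum_const, nsmul_eq_mul, prod_mul_distrib, prod_const]
  have hp : 0 ≤ ∏ t ∈ J, g t := prod_nonneg fun t _ => hg t
  rw [← mul_assoc]
  apply mul_le_mul_of_nonneg_right _ hp
  have := card_super n s J
  split_ifs at this with h
  · calc _ ≤ (Nat.choose (n - J.card) (s - J.card) : ℝ) := by exact_mod_cast this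
      _ ≤ _ := choose_ratio n s _ hs h hn
      _ = _ := by ring
  · have : ((powersetCard s (univ : Finset (Fin n))).filter (fun I => J ⊆ I)).card = 0 := by omega
    rw [this]; push_cast; positivity

lemma mgf_pos (n s : ℕ) (hs : s ≤ n) (hn : 0 < n) (h : Fin n → ℝ) (hh : ∀ t, 0 ≤ h t) :
    ∑ I ∈ powersetCard s (univ : Finset (Fin n)), Real.exp (∑ t ∈ I, h t)
      ≤ (Nat.choose n s : ℝ) * ∏ t, (1 + (s : ℝ) / n * (Real.exp (h t) - 1)) := by
  have := mgf_nonneg n s hs hn (fun t => Real.exp (h t) - 1) 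
    (fun t => by have := Real.one_le_exp (hh t); linarith)
  simpa [Real.exp_sum] using this

lemma mgf_neg (n s : ℕ) (hs : s ≤ n) (hn : 0 < n) (h : Fin n → ℝ) (hh : ∀ t, 0 ≤ h t) :
    ∑ I ∈ powersetCard s (univ : Finset (Fin n)), Real.exp (∑ t ∈ I, - h t)
      ≤ (Nat.choose n s : ℝ) * ∏ t, (1 + (s : ℝ) / n * (Real.exp (- h t) - 1)) := by
  have key := mgf_pos n (n - s) (by omega) hn h hh
  have e1 : ∑ I ∈ powersetCard s (univ : Finset (Fin n)), Real.exp (∑ t ∈ I, - h t)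
     = Real.exp (- ∑ t, h t) * 
      ∑ I ∈ powersetCard (n-s) (univ : Finset (Fin n)), Real.exp (∑ t ∈ I, h t) := by
    rw [mul_sum]
    apply sum_nbij' (fun I => Iᶜ) (fun I => Iᶜ)
    · intro I hI
      simp only [mem_powersetCard, subset_univ, true_and] at hI ⊢
      rw [card_compl, hI, Fintype.card_fin]
    · intro I hI
      simp only [mem_powersetCard, subset_univ, true_and] at hI ⊢
      rw [card_compl, hI, Fintype.card_fin]; omega
    · intro I _; simp
    · intro I _; simp
    · intro I _
      rw [← Real.exp_add, ← sum_add_sum_compl I h, sum_neg_distrib]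
      congr 1; ring
  have e2 : ∏ t, (1 + (s : ℝ) / n * (Real.exp (- h t) - 1)) = Real.exp (- ∑ t, h t) * 
     ∏ t, (1 + ((n - s : ℕ) : ℝ) / n * (Real.exp (h t) - 1)) := by
    rw [← sum_neg_distrib, Real.exp_sum, ← prod_mul_distrib]
    apply prod_congr rfl
    intro t _
    have : Real.exp (- h t) * Real.exp (h t) = 1 := by rw [← Real.exp_add]; simp
    have hn' : (n : ℝ) ≠ 0 := by positivity
    rw [Nat.cast_sub hs, sub_div, div_self hn']
    linear_combination (1 - (s:ℝ)/n) * (-this)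
  rw [e1, e2, ← Nat.choose_symm hs]
  calc _ ≤ _ := mul_le_mul_of_nonneg_left key (Real.exp_pos _).le
    _ = _ := by ring

lemma exp_quad (x : ℝ) (hx : |x| ≤ 1) : Real.exp x - 1 ≤ x + x ^ 2 := by
  have := Real.abs_exp_sub_one_sub_id_le hx
  have := (abs_le.1 this).2
  linarith

lemma markov (n s : ℕ) (h : Fin n → ℝ) (c M : ℝ) (P : Finset (Fin n) → Prop) [DecidablePred P]
    (hP : ∀ I, P I → c ≤ ∑ t ∈ I, h t)
    (hM : ∑ I ∈ powersetCard s (univ : Finset (Fin n)), Real.exp (∑ t ∈ I, h t) ≤ M) :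
    (((powersetCard s (univ : Finset (Fin n))).filter P).card : ℝ) ≤ M * Real.exp (-c) := by
  have : (((powersetCard s (univ : Finset (Fin n))).filter P).card : ℝ) * Real.exp c ≤ M := by
    refine le_trans ?_ hM
    rw [← nsmul_eq_mul, ← sum_const]
    refine le_trans (sum_le_sum (g := fun I => Real.exp (∑ t ∈ I, h t)) ?_) ?_
    · intro I hI
      exact Real.exp_le_exp.2 (hP I (mem_filter.1 hI).2)
    · exact sum_le_sum_of_subset_of_nonneg (filter_subset _ _) (fun _ _ _ => (Real.exp_pos _).le)
  rw [Real.exp_neg, ← div_eq_mul_inv, le_div_iff₀ (Real.exp_pos _)]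
  exact this

lemma prod_bound (n : ℕ) (p : ℝ) (hp0 : 0 ≤ p) (hp1 : p ≤ 1) (z : Fin n → ℝ) (l : ℝ) (hl : |l| ≤ 1)
    (hz0 : ∀ t, 0 ≤ z t) (hz1 : ∀ t, z t ≤ 1) :
    ∏ t, (1 + p * (Real.exp (l * z t) - 1)) ≤ Real.exp (p * ((l + l ^ 2) * ∑ t, z t)) := by
  rw [mul_sum, mul_sum, Real.exp_sum]
  apply prod_le_prod
  · intro t _
    have := Real.exp_pos (l * z t)
    nlinarith
  · intro t _
    have h1 : Real.exp (l * z t) - 1 ≤ (l + l^2) * z t := by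
      have h2 := exp_quad (l * z t) (by
        rw [abs_mul, abs_of_nonneg (hz0 t)]
        exact mul_le_one₀ hl (hz0 t) (hz1 t))
      have : (l * z t)^2 ≤ l^2 * z t := by
        have : z t ^ 2 ≤ z t := by nlinarith [hz0 t, hz1 t]
        rw [mul_pow]; exact mul_le_mul_of_nonneg_left this (sq_nonneg _)
      linarith
    have h3 := mul_le_mul_of_nonneg_left h1 hp0
    have h4 := Real.add_one_le_exp (p * ((l + l^2) * z t))
    linarith

lemma upper_tail (n s : ℕ) (hs : s ≤ n) (hn : 0 < n) (z : Fin n → ℝ) 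
    (hz0 : ∀ t, 0 ≤ z t) (hz1 : ∀ t, z t ≤ 1) (W η : ℝ) (hη0 : 0 ≤ η) (hη1 : η ≤ 1)
    (hW : ∑ t, z t ≤ W) (P : Finset (Fin n) → Prop) [DecidablePred P]
    (hP : ∀ I, P I → (s : ℝ) / n * W * (1 + η) ≤ ∑ t ∈ I, z t) :
    (((powersetCard s (univ : Finset (Fin n))).filter P).card : ℝ) ≤ 
      (Nat.choose n s : ℝ) * Real.exp (- ((s : ℝ) / n * W * η ^ 2 / 4)) := by
  have hp0 : 0 ≤ (s : ℝ) / n := by positivity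
  have hp1 : (s : ℝ) / n ≤ 1 := div_le_one_of_le₀ (by exact_mod_cast hs) (by positivity)
  have h1 := mgf_pos n s hs hn (fun t => (η / 2) * z t) (fun t => mul_nonneg (by linarith) (hz0 t))
  have h2 := prod_bound n ((s : ℝ) / n) hp0 hp1 z (η / 2) (by rw [abs_of_nonneg] <;> linarith) hz0 hz1
  have h3 := markov n s (fun t => (η / 2) * z t) (η / 2 * ((s : ℝ) / n * W * (1 + η))) _ P (by
    intro I hI
    rw [← mul_sum]
    exact mul_le_mul_of_nonneg_left (hP I hI) (by linarith)) h1
  refine h3.trans ?_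
  rw [mul_assoc]
  apply mul_le_mul_of_nonneg_left _ (by positivity)
  refine (mul_le_mul_of_nonneg_right h2 (Real.exp_pos _).le).trans ?_
  rw [← Real.exp_add, Real.exp_le_exp]
  have : (s : ℝ) / n * ((η / 2 + (η / 2)^2) * ∑ t, z t) ≤ (s : ℝ) / n * ((η / 2 + (η / 2)^2) * W) := by
    gcongr
  refine (add_le_add_left this _).trans (le_of_eq ?_)
  ring

lemma lower_tail (n s : ℕ) (hs : s ≤ n) (hn : 0 < n) (z : Fin n → ℝ) 
    (hz0 : ∀ t, 0 ≤ z t) (hz1 : ∀ t, z t ≤ 1) (W η : ℝ) (hη0 : 0 ≤ η) (hη1 : η ≤ 1)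
    (hW : W ≤ ∑ t, z t) (P : Finset (Fin n) → Prop) [DecidablePred P]
    (hP : ∀ I, P I → ∑ t ∈ I, z t ≤ (s : ℝ) / n * W * (1 - η)) :
    (((powersetCard s (univ : Finset (Fin n))).filter P).card : ℝ) ≤ 
      (Nat.choose n s : ℝ) * Real.exp (- ((s : ℝ) / n * W * η ^ 2 / 4)) := by
  have hp0 : 0 ≤ (s : ℝ) / n := by positivity
  have hp1 : (s : ℝ) / n ≤ 1 := div_le_one_of_le₀ (by exact_mod_cast hs) (by positivity)
  have h1 := mgf_neg n s hs hn (fun t => (η / 2) * z t) (fun t => mul_nonneg (by linarith) (hz0 t))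
  have h2 := prod_bound n ((s : ℝ) / n) hp0 hp1 z (-(η / 2)) 
    (by rw [abs_neg, abs_of_nonneg] <;> linarith) hz0 hz1
  simp only [← neg_mul] at h1
  have h3 := markov n s (fun t => -(η / 2) * z t) (-(η / 2) * ((s : ℝ) / n * W * (1 - η))) _ P (by
    intro I hI
    rw [← mul_sum]
    exact mul_le_mul_of_nonpos_left (hP I hI) (by linarith)) h1
  refine h3.trans ?_
  rw [mul_assoc]
  apply mul_le_mul_of_nonneg_left _ (by positivity)
  refine (mul_le_mul_of_nonneg_right h2 (Real.exp_pos _).le).trans ?_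
  rw [← Real.exp_add, Real.exp_le_exp]
  have : (s : ℝ) / n * ((-(η / 2) + (-(η / 2))^2) * ∑ t, z t) 
      ≤ (s : ℝ) / n * ((-(η / 2) + (-(η / 2))^2) * W) := by
    apply mul_le_mul_of_nonneg_left _ hp0
    apply mul_le_mul_of_nonpos_left hW
    nlinarith
  refine (add_le_add_left this _).trans (le_of_eq ?_)
  ring

lemma z_bounds {k : ℕ} (a x : Fin k → ℝ) (β W : ℝ) (hβ : 0 < β) (hW : 0 < W) (ha0 : ∀ j, 0 ≤ a j)
    (ha : ∀ j, a j ≤ β / W) (hx : inFullSimplex x) :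
    0 ≤ (∑ j, a j * x j) * (W / β) ∧ (∑ j, a j * x j) * (W / β) ≤ 1 := by
  constructor
  · apply mul_nonneg _ (by positivity)
    exact sum_nonneg fun j _ => mul_nonneg (ha0 j) (hx.1 j)
  · have h1 : ∑ j, a j * x j ≤ β / W := by
      calc ∑ j, a j * x j ≤ ∑ j, β / W * x j := 
            sum_le_sum fun j _ => mul_le_mul_of_nonneg_right (ha j) (hx.1 j)
        _ = β / W * ∑ j, x j := by rw [mul_sum]
        _ ≤ β / W * 1 := mul_le_mul_of_nonneg_left hx.2 (by positivity)
        _ = β / W := mul_one _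
    calc _ ≤ β / W * (W / β) := mul_le_mul_of_nonneg_right h1 (by positivity)
      _ = 1 := by field_simp

lemma scale_sum {n k : ℕ} (I : Finset (Fin n)) (a x : Fin n → Fin k → ℝ) (c : ℝ) :
    ∑ t ∈ I, ∑ j, a t j * (c * x t j) = c * ∑ t ∈ I, ∑ j, a t j * x t j := by
  simp_rw [mul_sum]
  exact sum_congr rfl fun t _ => sum_congr rfl fun j _ => by ring

lemma frac_ge (n s : ℕ) (hs : s ≤ n) (P : Finset (Fin n) → Prop) [DecidablePred P] (r : ℝ)
    (h : (((powersetCard s (univ : Finset (Fin n))).filter (fun I => ¬ P I)).card : ℝ)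
      ≤ (Nat.choose n s : ℝ) * r) : 1 - r ≤ subsetFrac n s P := by
  have hc : (0 : ℝ) < Nat.choose n s := by exact_mod_cast Nat.choose_pos hs
  have e1 : Nat.card {I : Finset (Fin n) // I.card = s} = Nat.choose n s := by
    rw [Nat.card_eq_fintype_card, Fintype.card_subtype]
    have : (univ.filter fun I : Finset (Fin n) => I.card = s) = powersetCard s univ := by
      ext; simp
    rw [this]; simp
  have e2 : Nat.card {I : Finset (Fin n) // I.card = s ∧ P I} 
      = ((powersetCard s (univ : Finset (Fin n))).filter P).card := by
    rw [Nat.card_eq_fintype_card, Fintype.card_subtype]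
    congr 1
    ext; simp
  have e3 := card_filter_add_card_filter_not (s := powersetCard s (univ : Finset (Fin n))) P
  rw [card_powersetCard, card_univ, Fintype.card_fin] at e3
  have e4 : ((((powersetCard s (univ : Finset (Fin n))).filter P).card : ℝ)) + 
     ((((powersetCard s (univ : Finset (Fin n))).filter (fun I => ¬ P I)).card : ℝ)) 
      = Nat.choose n s := by exact_mod_cast e3
  unfold subsetFrac
  rw [e1, e2, le_div_iff₀ hc]
  linarith

/-- Sampled LP Lemma, part (a): a feasible solution of `L`, scaled by
`(1 - ε'/2)` and restricted to a random `s`-subset `I`, is feasible for `L^I(1-ε')` for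
at least a `1 - 2δ` fraction of the `s`-subsets. -/
theorem stmt10 {n k mp mc : ℕ} (L : PCMC n k mp mc) (hL : L.NonnegData)
    (hm : 1 ≤ mp + mc)
    (ε δ : ℝ) (hε0 : 0 < ε) (hε1 : ε < 1) (hδ0 : 0 < δ) (hδ1 : δ < 1)
    (hδm : δ < (mp + mc : ℝ))
    -- the width of `L` is at least `32·log(m/δ)/ε²`:
    (hwA : ∀ t i j, L.A t i j ≤ L.b i * ε ^ 2 / (32 * Real.log ((mp + mc : ℝ) / δ)))
    (hwC : ∀ t i j, L.C t i j ≤ L.d i * ε ^ 2 / (32 * Real.log ((mp + mc : ℝ) / δ)))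
    (s : ℕ) (hs1 : ε ^ 2 * n ≤ (s : ℝ)) (hs2 : s ≤ n)
    (ε' : ℝ) (hε' : ε' = ε * Real.sqrt ((n : ℝ) / s))
    (xbar : Fin n → Fin k → ℝ) (hxbar : L.Feasible xbar) :
    1 - 2 * δ ≤ subsetFrac n s (fun I =>
      L.RestFeasible I (1 - ε') (fun t j => (1 - ε' / 2) * xbar t j)) := by
  classical
  obtain ⟨-, hA0, hC0, hb, hd⟩ := hL
  obtain ⟨hx, hxA, hxC⟩ := hxbar
  rcases Nat.eq_zero_or_pos n with hn | hn
  · subst hn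
    obtain rfl : s = 0 := by omega
    have h := frac_ge 0 0 le_rfl (fun I => L.RestFeasible I (1 - ε') 
      (fun t j => (1 - ε' / 2) * xbar t j)) 0 (by
      simp only [mul_zero, Nat.cast_nonpos, card_eq_zero, filter_eq_empty_iff, not_not]
      intro I _
      refine ⟨fun t => t.elim0, fun i => ?_, fun i => ?_⟩
      · rw [Finset.eq_empty_of_isEmpty I]; simp
      · rw [Finset.eq_empty_of_isEmpty I]; simp)
    linarith
  have hnR : (0 : ℝ) < n := by exact_mod_cast hn
  have hsR : (0 : ℝ) < s := lt_of_lt_of_le (by positivity) hs1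
  have hm0 : (0 : ℝ) < (mp + mc : ℝ) := by linarith
  set l := Real.log ((mp + mc : ℝ) / δ) with hl
  have hl0 : 0 < l := Real.log_pos ((one_lt_div hδ0).2 hδm)
  set W : ℝ := 32 * l / ε ^ 2 with hW
  have hW0 : 0 < W := by positivity
  set q : ℝ := (s : ℝ) / n with hq
  have hq0 : 0 < q := by positivity
  have hε'0 : 0 < ε' := by rw [hε']; positivity
  have hε'sq : ε' ^ 2 * q = ε ^ 2 := by
    rw [hε', mul_pow, Real.sq_sqrt (by positivity), hq]; field_simp
  have hqε : ε ^ 2 ≤ q := by rw [hq, le_div_iff₀ hnR]; exact hs1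
  have hε'1 : ε' ≤ 1 := by
    have : ε' ^ 2 ≤ 1 := by
      by_contra hcon
      push Not at hcon
      nlinarith
    nlinarith
  have hexp : Real.exp (-(q * W * (ε' / 2) ^ 2 / 4)) ≤ δ / (mp + mc : ℝ) := by
    have e : q * W * (ε' / 2) ^ 2 / 4 = 2 * l := by
      have : q * W * (ε' / 2) ^ 2 / 4 = W * (ε' ^ 2 * q) / 16 := by ring
      rw [this, hε'sq, hW]; field_simp; norm_num
    rw [e]
    calc Real.exp (-(2 * l)) ≤ Real.exp (-l) := Real.exp_le_exp.2 (by linarith)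
      _ = δ / (mp + mc : ℝ) := by
        rw [Real.exp_neg, hl, Real.exp_log (by positivity), inv_div]
  have hdiv : ∀ β : ℝ, β * ε ^ 2 / (32 * l) = β / W := by
    intro β; rw [hW]; field_simp
  let BP : Fin mp → Finset (Fin n) → Prop := fun i I =>
    q * L.b i < (1 - ε' / 2) * ∑ t ∈ I, ∑ j, L.A t i j * xbar t j
  let BC : Fin mc → Finset (Fin n) → Prop := fun i I =>
    (1 - ε' / 2) * ∑ t ∈ I, ∑ j, L.C t i j * xbar t j < (1 - ε') * (q * L.d i)
  have hBP : ∀ i, (((powersetCard s (univ : Finset (Fin n))).filter (BP i)).card : ℝ) ≤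
      (Nat.choose n s : ℝ) * (δ / (mp + mc : ℝ)) := by
    intro i
    have hz := fun t => z_bounds (L.A t i) (xbar t) (L.b i) W (hb i) hW0 (hA0 t i)
      (fun j => (hwA t i j).trans (hdiv _).le) (hx t)
    refine (upper_tail n s hs2 hn (fun t => (∑ j, L.A t i j * xbar t j) * (W / L.b i))
      (fun t => (hz t).1) (fun t => (hz t).2) W (ε' / 2) (by linarith) (by linarith) ?_ (BP i) ?_).trans
      (mul_le_mul_of_nonneg_left hexp (by positivity))
    · rw [← sum_mul]
      have := hb i
      calc _ ≤ L.b i * (W / L.b i) := mul_le_mul_of_nonneg_right (hxA i) (by positivity)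
        _ = W := by field_simp
    · intro I hI
      have hbi := hb i
      have hnn : 0 ≤ ∑ t ∈ I, (∑ j, L.A t i j * xbar t j) * (W / L.b i) :=
        sum_nonneg fun t _ => (hz t).1
      have h1 : q * W ≤ (1 - ε' / 2) * ∑ t ∈ I, (∑ j, L.A t i j * xbar t j) * (W / L.b i) := by
        rw [← sum_mul, ← mul_assoc]
        have := mul_le_mul_of_nonneg_right hI.le (by positivity : 0 ≤ W / L.b i)
        refine le_trans (le_of_eq ?_) this
        field_simp
      have h2 := mul_le_mul_of_nonneg_right h1 (by linarith : 0 ≤ 1 + ε' / 2)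
      refine h2.trans ?_
      nlinarith [mul_nonneg hnn (sq_nonneg ε')]
  have hBC : ∀ i, (((powersetCard s (univ : Finset (Fin n))).filter (BC i)).card : ℝ) ≤
      (Nat.choose n s : ℝ) * (δ / (mp + mc : ℝ)) := by
    intro i
    have hz := fun t => z_bounds (L.C t i) (xbar t) (L.d i) W (hd i) hW0 (hC0 t i)
      (fun j => (hwC t i j).trans (hdiv _).le) (hx t)
    refine (lower_tail n s hs2 hn (fun t => (∑ j, L.C t i j * xbar t j) * (W / L.d i))
      (fun t => (hz t).1) (fun t => (hz t).2) W (ε' / 2) (by linarith) (by linarith) ?_ (BC i) ?_).trans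
      (mul_le_mul_of_nonneg_left hexp (by positivity))
    · rw [← sum_mul]
      have := hd i
      calc W = L.d i * (W / L.d i) := by field_simp
        _ ≤ _ := mul_le_mul_of_nonneg_right (hxC i) (by positivity)
    · intro I hI
      have hdi := hd i
      have h1 : (1 - ε' / 2) * ∑ t ∈ I, (∑ j, L.C t i j * xbar t j) * (W / L.d i)
          ≤ (1 - ε') * (q * W) := by
        rw [← sum_mul, ← mul_assoc]
        have := mul_le_mul_of_nonneg_right hI.le (by positivity : 0 ≤ W / L.d i)
        refine le_trans this (le_of_eq ?_)
        field_simp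
      have hqW : 0 ≤ q * W := by positivity
      have h2 : (1 - ε') * (q * W) ≤ (1 - ε' / 2) * (q * W * (1 - ε' / 2)) := by
        nlinarith [mul_nonneg hqW (sq_nonneg ε')]
      exact le_of_mul_le_mul_left (h1.trans h2) (by linarith)
  have main := frac_ge n s hs2 (fun I => L.RestFeasible I (1 - ε') 
      (fun t j => (1 - ε' / 2) * xbar t j)) δ (by
    have hsub : (powersetCard s (univ : Finset (Fin n))).filter (fun I => 
        ¬ L.RestFeasible I (1 - ε') (fun t j => (1 - ε' / 2) * xbar t j)) ⊆
        (univ.biUnion fun i => (powersetCard s (univ : Finset (Fin n))).filter (BP i)) ∪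
        (univ.biUnion fun i => (powersetCard s (univ : Finset (Fin n))).filter (BC i)) := by
      intro I hI
      rw [mem_filter] at hI
      obtain ⟨hI, hbad⟩ := hI
      have hcard : I.card = s := (mem_powersetCard.1 hI).2
      by_contra hcon
      simp only [mem_union, mem_biUnion, mem_univ, true_and, mem_filter, hI, not_or, 
        not_exists] at hcon
      apply hbad
      refine ⟨fun t => ⟨fun j => mul_nonneg (by linarith) ((hx t).1 j), ?_⟩, fun i => ?_, fun i => ?_⟩
      · rw [← mul_sum]
        exact mul_le_one₀ (by linarith) (sum_nonneg fun j _ => (hx t).1 j) (hx t).2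
      · rw [scale_sum I (fun t => L.A t i) xbar, hcard]
        exact not_lt.1 (hcon.1 i)
      · rw [scale_sum I (fun t => L.C t i) xbar, hcard]
        exact not_lt.1 (hcon.2 i)
    have h1 := (card_le_card hsub).trans ((card_union_le _ _).trans 
      (add_le_add card_biUnion_le card_biUnion_le))
    have h2 : ((((powersetCard s (univ : Finset (Fin n))).filter (fun I => 
        ¬ L.RestFeasible I (1 - ε') (fun t j => (1 - ε' / 2) * xbar t j))).card : ℕ) : ℝ) ≤
        ∑ i, (((powersetCard s (univ : Finset (Fin n))).filter (BP i)).card : ℝ) + 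
        ∑ i, (((powersetCard s (univ : Finset (Fin n))).filter (BC i)).card : ℝ) := by
      exact_mod_cast h1
    refine h2.trans ((add_le_add (sum_le_sum fun i _ => hBP i) (sum_le_sum fun i _ => hBC i)).trans 
      (le_of_eq ?_))
    simp only [sum_const, card_univ, Fintype.card_fin, nsmul_eq_mul]
    field_simp)
  linarith

end
end

section
/- Let ε, δ ∈ (0,1) and ρ ≥ 1, and let L be a feasible PCMC LP with m = m_p + m_c ≥ 1 constraints, δ < m, width at least 32·log(m/δ)/ε², and all item values satisfying π^t_j ≤ ρ·OPT(L)·ε²/(32·log(m/δ)). Let s be an integer with ε²·n ≤ s ≤ n and set ε' = ε·√(n/s). Then the fraction of s-element subsets I ⊆ {1,…,n} for which the restricted LP L^I(1−ε') admits a feasible solution of value at least (1 − ρε'/2)·(s/n)·OPT(L) is at least 1 − 4δ. -/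
open Finset

noncomputable section

/-- elementary symmetric sum. -/
def esy {α : Type*} (z : α → ℝ) (S : Finset α) (s : ℕ) : ℝ :=
  ∑ I ∈ S.powersetCard s, ∏ t ∈ I, z t

lemma esy_nonneg {α : Type*} (z : α → ℝ) (hz : ∀ t, 0 ≤ z t) (S : Finset α) (s : ℕ) :
    0 ≤ esy z S s :=
  Finset.sum_nonneg fun _ _ => Finset.prod_nonneg fun _ _ => hz _

lemma esy_insert {α : Type*} [DecidableEq α] (z : α → ℝ) (S : Finset α) (s : ℕ) (i : α)
    (hi : i ∉ S) : esy z (insert i S) (s + 1) = esy z S (s + 1) + z i * esy z S s := by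
  unfold esy
  rw [Finset.powersetCard_succ_insert hi, Finset.sum_union, Finset.mul_sum]
  · congr 1
    rw [Finset.sum_image]
    · apply Finset.sum_congr rfl
      intro I hI
      rw [Finset.prod_insert]
      exact fun h => hi ((Finset.mem_powersetCard.1 hI).1 h)
    · intro I hI J hJ h
      have h1 : i ∉ I := fun h => hi ((Finset.mem_powersetCard.1 hI).1 h)
      have h2 : i ∉ J := fun h => hi ((Finset.mem_powersetCard.1 hJ).1 h)
      have := congrArg (fun K => Finset.erase K i) h
      simpa [Finset.erase_insert h1, Finset.erase_insert h2] using this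
  · rw [Finset.disjoint_left]
    intro I hI hI'
    obtain ⟨J, hJ, rfl⟩ := Finset.mem_image.1 hI'
    exact hi ((Finset.mem_powersetCard.1 hI).1 (Finset.mem_insert_self _ _))

lemma sum_esy_erase {α : Type*} [DecidableEq α] (z : α → ℝ) (S : Finset α) (s : ℕ) :
    ∑ i ∈ S, esy z (S.erase i) s = ((S.card : ℝ) - s) * esy z S s := by
  unfold esy
  have h1 : ∀ i ∈ S, ∑ I ∈ (S.erase i).powersetCard s, ∏ t ∈ I, z t
      = ∑ I ∈ S.powersetCard s, if i ∉ I then ∏ t ∈ I, z t else 0 := by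
    intro i hi
    rw [← Finset.sum_filter]
    apply Finset.sum_congr _ fun _ _ => rfl
    ext I
    simp only [Finset.mem_powersetCard, Finset.mem_filter, Finset.subset_erase]
    tauto
  rw [Finset.sum_congr rfl h1, Finset.sum_comm, Finset.mul_sum]
  apply Finset.sum_congr rfl
  intro I hI
  obtain ⟨hI1, hI2⟩ := Finset.mem_powersetCard.1 hI
  rw [← Finset.sum_filter, Finset.sum_const, nsmul_eq_mul]
  congr 1
  have : {i ∈ S | i ∉ I} = S \ I := by ext; simp
  rw [this, Finset.card_sdiff_of_subset hI1, hI2, Nat.cast_sub]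
  rw [← hI2]; exact Finset.card_le_card hI1

lemma sum_mul_esy_erase {α : Type*} [DecidableEq α] (z : α → ℝ) (S : Finset α) (s : ℕ) :
    ∑ i ∈ S, esy z (S.erase i) s * z i = ((s : ℝ) + 1) * esy z S (s + 1) := by
  have h1 : ∀ i ∈ S, esy z (S.erase i) s * z i = esy z S (s + 1) - esy z (S.erase i) (s + 1) := by
    intro i hi
    have := esy_insert z (S.erase i) s i (Finset.notMem_erase _ _)
    rw [Finset.insert_erase hi] at this
    rw [this]; ring
  rw [Finset.sum_congr rfl h1, Finset.sum_sub_distrib, sum_esy_erase, Finset.sum_const,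
    nsmul_eq_mul]
  push_cast; ring

lemma esy_antivary {α : Type*} [DecidableEq α] (z : α → ℝ) (hz : ∀ t, 0 ≤ z t) (S : Finset α)
    (s : ℕ) : AntivaryOn (fun i => esy z (S.erase i) s) z S := by
  intro i hi j hj hij
  have hne : i ≠ j := fun h => by simp [h] at hij
  cases s with
  | zero => simp [esy]
  | succ s =>
    have h1 := esy_insert z ((S.erase i).erase j) s j (Finset.notMem_erase _ _)
    have h2 := esy_insert z ((S.erase j).erase i) s i (Finset.notMem_erase _ _)
    rw [Finset.insert_erase (Finset.mem_erase.2 ⟨hne.symm, hj⟩)] at h1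
    rw [Finset.insert_erase (Finset.mem_erase.2 ⟨hne, hi⟩), Finset.erase_right_comm] at h2
    have h3 := esy_nonneg z hz ((S.erase i).erase j) s
    simp only
    rw [h1, h2]
    nlinarith

lemma maclaurin {α : Type*} [DecidableEq α] (z : α → ℝ) (hz : ∀ t, 0 ≤ z t) (S : Finset α)
    (s : ℕ) : esy z S s * (S.card : ℝ) ^ s ≤ (S.card.choose s : ℝ) * (∑ t ∈ S, z t) ^ s := by
  have he : 0 ≤ ∑ t ∈ S, z t := Finset.sum_nonneg fun _ _ => hz _
  induction s with
  | zero => simp [esy]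
  | succ s ih =>
    rcases lt_or_ge s S.card with h | h
    · have h1 := (esy_antivary z hz S s).card_mul_sum_le_sum_mul_sum
      rw [sum_mul_esy_erase, sum_esy_erase] at h1
      have h2 : (S.card.choose (s+1) : ℝ) * (s + 1) = S.card.choose s * (S.card - s) := by
        have := Nat.choose_succ_right_eq S.card s
        rw [← Nat.cast_sub h.le]
        exact_mod_cast this
      have h3 : (0:ℝ) ≤ S.card - s := by
        rw [← Nat.cast_sub h.le]; positivity
      have hs : (0:ℝ) < s + 1 := by positivity
      refine le_of_mul_le_mul_left ?_ hs
      calc ((s:ℝ) + 1) * (esy z S (s + 1) * (S.card:ℝ) ^ (s + 1))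
          = (S.card * ((s + 1) * esy z S (s + 1))) * (S.card:ℝ) ^ s := by ring
        _ ≤ ((S.card - s) * esy z S s * ∑ t ∈ S, z t) * (S.card:ℝ) ^ s := by gcongr
        _ = (S.card - s) * (∑ t ∈ S, z t) * (esy z S s * (S.card:ℝ) ^ s) := by ring
        _ ≤ (S.card - s) * (∑ t ∈ S, z t) * ((S.card.choose s : ℝ) * (∑ t ∈ S, z t) ^ s) := by
            gcongr
        _ = ((S.card.choose s : ℝ) * (S.card - s)) * (∑ t ∈ S, z t) ^ (s+1) := by ring
        _ = _ := by rw [← h2]; ring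
    · have : esy z S (s+1) = 0 := by
        unfold esy
        rw [Finset.powersetCard_eq_empty.2 (by omega)]; simp
      rw [this]; simp only [zero_mul]; positivity

/-- MGF bound for sampling without replacement. -/
lemma mgf_bound {n s : ℕ} (hn : 0 < n) (y : Fin n → ℝ) (hy0 : ∀ t, 0 ≤ y t) (hy1 : ∀ t, y t ≤ 1)
    (θ : ℝ) : ∑ I ∈ (Finset.univ : Finset (Fin n)).powersetCard s, Real.exp (θ * ∑ t ∈ I, y t)
      ≤ (n.choose s : ℝ) * Real.exp (((s:ℝ) / n * ∑ t, y t) * (Real.exp θ - 1)) := by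
  have hn' : (0:ℝ) < n := by exact_mod_cast hn
  have h1 := maclaurin (fun t => Real.exp (θ * y t)) (fun t => (Real.exp_pos _).le)
    (Finset.univ : Finset (Fin n)) s
  have h2 : esy (fun t => Real.exp (θ * y t)) (Finset.univ : Finset (Fin n)) s
      = ∑ I ∈ (Finset.univ : Finset (Fin n)).powersetCard s, Real.exp (θ * ∑ t ∈ I, y t) := by
    unfold esy
    apply Finset.sum_congr rfl
    intro I _
    rw [← Real.exp_sum, Finset.mul_sum]
  rw [h2] at h1
  simp only [Finset.card_univ, Fintype.card_fin] at h1
  have h3 : ∑ t, Real.exp (θ * y t) ≤ n * Real.exp ((1 / n * ∑ t, y t) * (Real.exp θ - 1)) := by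
    calc ∑ t, Real.exp (θ * y t) ≤ ∑ t, (1 + y t * (Real.exp θ - 1)) := by
          apply Finset.sum_le_sum
          intro t _
          have := convexOn_exp.2 (Set.mem_univ (0:ℝ)) (Set.mem_univ θ)
            (sub_nonneg.2 (hy1 t)) (hy0 t) (by ring)
          simp only [smul_eq_mul, mul_zero, zero_add, Real.exp_zero, mul_one] at this
          rw [mul_comm θ]
          linarith
      _ = n * ((1 / n * ∑ t, y t) * (Real.exp θ - 1) + 1) := by
          rw [Finset.sum_add_distrib, ← Finset.sum_mul]
          simp only [Finset.sum_const, Finset.card_univ, Fintype.card_fin, nsmul_eq_mul]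
          field_simp
          ring
      _ ≤ _ := by
          gcongr
          exact Real.add_one_le_exp _
  have h4 : (∑ t, Real.exp (θ * y t)) ^ s
      ≤ (n:ℝ) ^ s * Real.exp (((s:ℝ) / n * ∑ t, y t) * (Real.exp θ - 1)) := by
    calc _ ≤ (n * Real.exp ((1 / n * ∑ t, y t) * (Real.exp θ - 1))) ^ s := by
          gcongr
          
      _ = _ := by
          rw [mul_pow, ← Real.exp_nat_mul]
          congr 2
          ring
  have h5 : (0:ℝ) < (n:ℝ) ^ s := by positivity
  refine le_of_mul_le_mul_right ?_ h5
  calc _ ≤ _ := h1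
    _ ≤ (n.choose s : ℝ) * _ := mul_le_mul_of_nonneg_left h4 (by positivity)
    _ = _ := by ring

/-- Markov step. -/
lemma markov_step {n s : ℕ} (hn : 0 < n) (y : Fin n → ℝ) (hy0 : ∀ t, 0 ≤ y t)
    (hy1 : ∀ t, y t ≤ 1) (θ T : ℝ) (P : Finset (Fin n) → Prop) [DecidablePred P]
    (hP : ∀ I, P I → θ * T ≤ θ * ∑ t ∈ I, y t) :
    ((((Finset.univ : Finset (Fin n)).powersetCard s).filter P).card : ℝ)
      ≤ (n.choose s : ℝ) * Real.exp (((s:ℝ) / n * ∑ t, y t) * (Real.exp θ - 1) - θ * T) := by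
  rw [Real.exp_sub, ← mul_div_assoc, le_div_iff₀ (Real.exp_pos _)]
  refine le_trans ?_ (mgf_bound hn y hy0 hy1 θ)
  rw [← nsmul_eq_mul]
  refine le_trans (Finset.card_nsmul_le_sum _ _ _ ?_) (Finset.sum_le_sum_of_subset_of_nonneg
    (Finset.filter_subset P _) fun _ _ _ => (Real.exp_pos _).le)
  intro I hI
  exact Real.exp_le_exp.2 (hP I (Finset.mem_filter.1 hI).2)

lemma chernoff_upper {n s : ℕ} (hn : 0 < n) (y : Fin n → ℝ) (hy0 : ∀ t, 0 ≤ y t)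
    (hy1 : ∀ t, y t ≤ 1) (u T : ℝ) (hu0 : 0 ≤ u) (hu1 : u < 1) (hT : 0 ≤ T)
    (hM : (s:ℝ) / n * ∑ t, y t ≤ (1 - u) * T) (P : Finset (Fin n) → Prop) [DecidablePred P]
    (hP : ∀ I, P I → T ≤ ∑ t ∈ I, y t) :
    ((((Finset.univ : Finset (Fin n)).powersetCard s).filter P).card : ℝ)
      ≤ (n.choose s : ℝ) * Real.exp (-(T * u ^ 2 / 2)) := by
  have h1u : 0 < 1 - u := by linarith
  have hlog : Real.log (1 - u) ≤ - u - u ^ 2 / 2 := by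
    have h := Real.hasSum_pow_div_log_of_abs_lt_one (x := u) (by rw [abs_of_nonneg hu0]; exact hu1)
    have h2 := sum_le_hasSum (Finset.range 2) (fun i _ => by positivity) h
    simp [Finset.sum_range_succ] at h2
    norm_num at h2
    linarith
  have hθ : 0 ≤ -Real.log (1 - u) := by nlinarith
  refine le_trans (markov_step hn y hy0 hy1 (-Real.log (1 - u)) T P
    fun I hI => mul_le_mul_of_nonneg_left (hP I hI) hθ) ?_
  gcongr
  rw [Real.exp_neg, Real.exp_log h1u]
  have h3 : (1 - u)⁻¹ - 1 = u / (1 - u) := by field_simp; ring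
  rw [h3]
  have h4 : (s:ℝ) / n * ∑ t, y t * 1 ≤ (1 - u) * T := by simpa using hM
  have h5 : ((s:ℝ) / n * ∑ t, y t) * (u / (1 - u)) ≤ ((1 - u) * T) * (u / (1 - u)) := by
    gcongr
  have h6 : ((1 - u) * T) * (u / (1 - u)) = T * u := by field_simp
  nlinarith

lemma chernoff_lower {n s : ℕ} (hn : 0 < n) (y : Fin n → ℝ) (hy0 : ∀ t, 0 ≤ y t)
    (hy1 : ∀ t, y t ≤ 1) (M T : ℝ) (hM0 : 0 < M) (hT : T ≤ M)
    (hM : M ≤ (s:ℝ) / n * ∑ t, y t) (P : Finset (Fin n) → Prop) [DecidablePred P]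
    (hP : ∀ I, P I → ∑ t ∈ I, y t ≤ T) :
    ((((Finset.univ : Finset (Fin n)).powersetCard s).filter P).card : ℝ)
      ≤ (n.choose s : ℝ) * Real.exp (-((M - T) ^ 2 / (2 * M))) := by
  obtain ⟨θ, hθ⟩ : ∃ θ, θ = (M - T) / M := ⟨_, rfl⟩
  have hθ0 : 0 ≤ θ := by rw [hθ]; exact div_nonneg (by linarith) hM0.le
  have hTM : T = M - θ * M := by rw [hθ]; field_simp; ring
  have hexp : Real.exp (-θ) ≤ 1 - θ + θ ^ 2 / 2 := by
    have h1 := Real.quadratic_le_exp_of_nonneg hθ0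
    rw [Real.exp_neg]
    rw [inv_le_iff_one_le_mul₀ (Real.exp_pos _)]
    have h2 : 0 < 1 - θ + θ ^ 2 / 2 := by nlinarith [sq_nonneg (θ - 1)]
    nlinarith [mul_le_mul_of_nonneg_left h1 h2.le, sq_nonneg (θ ^ 2)]
  have hexp1 : Real.exp (-θ) ≤ 1 := Real.exp_le_one_iff.2 (by linarith)
  refine le_trans (markov_step hn y hy0 hy1 (-θ) T P fun I hI => ?_) ?_
  · nlinarith [hP I hI]
  gcongr
  have h1 : (M - T) ^ 2 / (2 * M) = θ ^ 2 * M / 2 := by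
    rw [hTM]; field_simp; ring
  rw [h1]
  have h2 : ((s:ℝ) / n * ∑ t, y t) * (Real.exp (-θ) - 1) ≤ M * (Real.exp (-θ) - 1) :=
    mul_le_mul_of_nonpos_right hM (by linarith)
  have h3 : M * (Real.exp (-θ) - 1) ≤ M * (-θ + θ ^ 2 / 2) := by gcongr; linarith
  rw [hTM]
  nlinarith

lemma aux_up {n s : ℕ} (hn : 0 < n) (f : Fin n → ℝ) (p u W R Λ : ℝ) (hp : p = (s:ℝ) / n)
    (hp0 : 0 < p) (hW : 0 < W) (hR : 0 < R) (hu0 : 0 ≤ u) (hu1 : u < 1)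
    (hΛ : p * W * u ^ 2 = 2 * Λ)
    (hf0 : ∀ t, 0 ≤ f t) (hf1 : ∀ t, f t ≤ R / W) (hM : ∑ t, f t ≤ (1 - u) * R)
    (P : Finset (Fin n) → Prop) [DecidablePred P] (hP : ∀ I, P I → p * R ≤ ∑ t ∈ I, f t) :
    ((((Finset.univ : Finset (Fin n)).powersetCard s).filter P).card : ℝ)
      ≤ (n.choose s : ℝ) * Real.exp (-Λ) := by
  have hWR : 0 < W / R := by positivity
  have := chernoff_upper (s := s) hn (fun t => W / R * f t) (fun t => mul_nonneg hWR.le (hf0 t))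
    (fun t => by
      calc W / R * f t ≤ W / R * (R / W) := by gcongr; exact hf1 t
        _ = 1 := by field_simp) u (p * W) hu0 hu1 (by positivity)
    (by
      rw [← Finset.mul_sum, ← hp]
      calc p * (W / R * ∑ t, f t) ≤ p * (W / R * ((1 - u) * R)) := by gcongr
        _ = _ := by field_simp) P
    (fun I hI => by
      rw [← Finset.mul_sum]
      calc p * W = W / R * (p * R) := by field_simp
        _ ≤ _ := by gcongr; exact hP I hI)
  rw [hΛ] at this
  simpa using this

lemma aux_low {n s : ℕ} (hn : 0 < n) (f : Fin n → ℝ) (p u v W R Λ : ℝ) (hp : p = (s:ℝ) / n)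
    (hp0 : 0 < p) (hW : 0 < W) (hR : 0 < R) (hu0 : 0 ≤ u) (hu1 : u < 1) (hv : u ≤ v)
    (hΛ : 2 * Λ ≤ p * W * (v - u) ^ 2)
    (hf0 : ∀ t, 0 ≤ f t) (hf1 : ∀ t, f t ≤ R / W) (hM : (1 - u) * R ≤ ∑ t, f t)
    (P : Finset (Fin n) → Prop) [DecidablePred P]
    (hP : ∀ I, P I → ∑ t ∈ I, f t ≤ (1 - v) * (p * R)) :
    ((((Finset.univ : Finset (Fin n)).powersetCard s).filter P).card : ℝ)
      ≤ (n.choose s : ℝ) * Real.exp (-Λ) := by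
  have hWR : 0 < W / R := by positivity
  have h1u : 0 < 1 - u := by linarith
  have hpW : 0 < p * W := by positivity
  have := chernoff_lower (s := s) hn (fun t => W / R * f t) (fun t => mul_nonneg hWR.le (hf0 t))
    (fun t => by
      calc W / R * f t ≤ W / R * (R / W) := by gcongr; exact hf1 t
        _ = 1 := by field_simp) ((1 - u) * (p * W)) ((1 - v) * (p * W)) (by positivity)
    (by gcongr)
    (by
      rw [← Finset.mul_sum, ← hp]
      calc (1 - u) * (p * W) = p * (W / R * ((1 - u) * R)) := by field_simp
        _ ≤ _ := by gcongr) P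
    (fun I hI => by
      rw [← Finset.mul_sum]
      calc _ ≤ W / R * ((1 - v) * (p * R)) := by gcongr; exact hP I hI
        _ = (1 - v) * (p * W) := by field_simp)
  refine this.trans ?_
  gcongr
  rw [le_div_iff₀ (by positivity)]
  have h1 : ((1 - u) * (p * W) - (1 - v) * (p * W)) ^ 2 = (p * W) * (p * W * (v - u) ^ 2) := by ring
  rw [h1]
  have h2 : 0 ≤ p * W * (v - u) ^ 2 := by positivity
  rcases le_or_gt Λ 0 with h | h
  · have : Λ * (2 * ((1 - u) * (p * W))) ≤ 0 := mul_nonpos_of_nonpos_of_nonneg h (by positivity)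
    have : 0 ≤ (p * W) * (p * W * (v - u) ^ 2) := by positivity
    linarith
  · calc Λ * (2 * ((1 - u) * (p * W))) = (1 - u) * ((p * W) * (2 * Λ)) := by ring
      _ ≤ 1 * ((p * W) * (2 * Λ)) := by gcongr; linarith
      _ ≤ _ := by rw [one_mul]; gcongr

lemma exists_opt {n k mp mc : ℕ} (L : PCMC n k mp mc) (hfeas : ∃ x, L.Feasible x) :
    ∃ x, L.Feasible x ∧ L.value x = L.opt := by
  have hcomp : IsCompact {x | L.Feasible x} := by
    have hK : IsCompact (Set.pi Set.univ fun _ : Fin n => Set.pi Set.univ fun _ : Fin k =>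
        Set.Icc (0:ℝ) 1) := isCompact_univ_pi fun _ => isCompact_univ_pi fun _ => isCompact_Icc
    refine hK.of_isClosed_subset ?_ ?_
    · simp only [PCMC.Feasible, inFullSimplex, Set.ofPred_and, Set.ofPred_forall]
      refine IsClosed.inter ?_ (IsClosed.inter ?_ ?_)
      · refine isClosed_iInter fun t => IsClosed.inter (isClosed_iInter fun j => ?_) ?_
        · exact isClosed_le (by fun_prop) (by fun_prop)
        · exact isClosed_le (by fun_prop) (by fun_prop)
      · exact isClosed_iInter fun i => isClosed_le (by fun_prop) (by fun_prop)
      · exact isClosed_iInter fun i => isClosed_le (by fun_prop) (by fun_prop)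
    · intro x hx t _ j _
      refine ⟨(hx.1 t).1 j, le_trans ?_ (hx.1 t).2⟩
      exact Finset.single_le_sum (f := x t) (fun j _ => (hx.1 t).1 j) (Finset.mem_univ j)
  have hcont : Continuous L.value := by unfold PCMC.value; fun_prop
  obtain ⟨x, hx, hmax⟩ := hcomp.exists_isMaxOn hfeas hcont.continuousOn
  refine ⟨x, hx, ?_⟩
  have : IsGreatest {v : ℝ | ∃ x, L.Feasible x ∧ v = L.value x} (L.value x) := by
    refine ⟨⟨x, hx, rfl⟩, ?_⟩
    rintro v ⟨y, hy, rfl⟩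
    exact hmax hy
  exact this.csSup_eq.symm

lemma frac_bound (n s : ℕ) (hs : s ≤ n) (P : Finset (Fin n) → Prop) [DecidablePred P] (η : ℝ)
    (h : ((((Finset.univ : Finset (Fin n)).powersetCard s).filter fun I => ¬ P I).card : ℝ)
      ≤ (n.choose s : ℝ) * η) : 1 - η ≤ subsetFrac n s P := by
  unfold subsetFrac
  rw [Nat.subtype_card (((Finset.univ : Finset (Fin n)).powersetCard s).filter P) (by simp),
    Nat.subtype_card ((Finset.univ : Finset (Fin n)).powersetCard s) (by simp)]
  have h1 := Finset.card_filter_add_card_filter_not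
    (s := (Finset.univ : Finset (Fin n)).powersetCard s) P
  rw [Finset.card_powersetCard] at *
  simp only [Finset.card_univ, Fintype.card_fin] at *
  have h2 : (0:ℝ) < n.choose s := by exact_mod_cast Nat.choose_pos hs
  rw [le_div_iff₀ h2]
  have h3 : ((((Finset.univ : Finset (Fin n)).powersetCard s).filter P).card : ℝ) +
    ((((Finset.univ : Finset (Fin n)).powersetCard s).filter fun I => ¬ P I).card : ℝ)
      = n.choose s := by exact_mod_cast h1
  linarith

lemma simplex_sum_nonneg {k : ℕ} (w x : Fin k → ℝ) (hw : ∀ j, 0 ≤ w j) (hx : inFullSimplex x) :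
    0 ≤ ∑ j, w j * x j := Finset.sum_nonneg fun j _ => mul_nonneg (hw j) (hx.1 j)

lemma simplex_sum_le {k : ℕ} (w x : Fin k → ℝ) (B : ℝ) (hB : 0 ≤ B) (hw : ∀ j, w j ≤ B)
    (hx : inFullSimplex x) : ∑ j, w j * x j ≤ B := by
  calc ∑ j, w j * x j ≤ ∑ j, B * x j :=
        Finset.sum_le_sum fun j _ => mul_le_mul_of_nonneg_right (hw j) (hx.1 j)
    _ = B * ∑ j, x j := by rw [Finset.mul_sum]
    _ ≤ B * 1 := by gcongr; exact hx.2
    _ = B := mul_one B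

set_option maxHeartbeats 2000000 in
/-- Sampled LP Lemma, part (b): for at least a `1 - 4δ` fraction of
the `s`-subsets `I`, the restricted LP `L^I(1-ε')` admits a feasible solution of value
at least `(1 - ρε'/2)·(s/n)·OPT(L)`. -/
theorem stmt11 {n k mp mc : ℕ} (L : PCMC n k mp mc) (hL : L.NonnegData)
    (hfeas : ∃ x, L.Feasible x) (hm : 1 ≤ mp + mc)
    (ε δ ρ : ℝ) (hε0 : 0 < ε) (hε1 : ε < 1) (hδ0 : 0 < δ) (hδ1 : δ < 1)
    (hρ : 1 ≤ ρ) (hδm : δ < (mp + mc : ℝ))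
    -- the width of `L` is at least `32·log(m/δ)/ε²`:
    (hwA : ∀ t i j, L.A t i j ≤ L.b i * ε ^ 2 / (32 * Real.log ((mp + mc : ℝ) / δ)))
    (hwC : ∀ t i j, L.C t i j ≤ L.d i * ε ^ 2 / (32 * Real.log ((mp + mc : ℝ) / δ)))
    -- all item values are at most `ρ·OPT(L)·ε²/(32·log(m/δ))`:
    (hwπ : ∀ t j, L.pi t j ≤ ρ * L.opt * ε ^ 2 / (32 * Real.log ((mp + mc : ℝ) / δ)))
    (s : ℕ) (hs1 : ε ^ 2 * n ≤ (s : ℝ)) (hs2 : s ≤ n)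
    (ε' : ℝ) (hε' : ε' = ε * Real.sqrt ((n : ℝ) / s)) :
    1 - 4 * δ ≤ subsetFrac n s (fun I => ∃ x, L.RestFeasible I (1 - ε') x ∧
      (1 - ρ * ε' / 2) * ((s : ℝ) / n) * L.opt ≤ L.restValue I x) := by
  classical
  obtain ⟨hπ0, hA0, hC0, hb0, hd0⟩ := hL
  rcases Nat.eq_zero_or_pos n with hn | hn
  · subst hn
    obtain rfl : s = 0 := by omega
    obtain ⟨x, hx⟩ := hfeas
    refine le_trans ?_ (frac_bound 0 0 le_rfl _ 0 ?_)
    · linarith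
    · rw [mul_zero, Nat.cast_nonpos, Finset.card_eq_zero, Finset.filter_eq_empty_iff]
      intro I hI
      rw [not_not]
      obtain rfl : I = ∅ := by simpa using hI
      refine ⟨x, ⟨hx.1, fun i => ?_, fun i => ?_⟩, ?_⟩
      · simp
      · simp
      · simp [PCMC.restValue]
  obtain ⟨xs, hxs, hval⟩ := exists_opt L hfeas
  have hn' : (0:ℝ) < n := by exact_mod_cast hn
  have hs0 : (0:ℝ) < s := lt_of_lt_of_le (by positivity) hs1
  have hm' : (1:ℝ) ≤ (mp + mc : ℝ) := by exact_mod_cast hm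
  obtain ⟨m, hmdef⟩ : ∃ m : ℝ, m = (mp + mc : ℝ) := ⟨_, rfl⟩
  simp only [← hmdef] at hm' hδm hwA hwC hwπ
  obtain ⟨Λ, hΛ⟩ : ∃ Λ : ℝ, Λ = Real.log (m / δ) := ⟨_, rfl⟩
  simp only [← hΛ] at hwA hwC hwπ
  have hmδ : 1 < m / δ := by rw [lt_div_iff₀ hδ0]; linarith
  have hΛ0 : 0 < Λ := by rw [hΛ]; exact Real.log_pos hmδ
  have hexp : Real.exp (-Λ) = δ / m := by
    rw [hΛ, Real.exp_neg, Real.exp_log (by linarith), inv_div]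
  obtain ⟨p, hp⟩ : ∃ p : ℝ, p = (s:ℝ) / n := ⟨_, rfl⟩
  have hp0 : 0 < p := by rw [hp]; positivity
  obtain ⟨W, hW⟩ : ∃ W : ℝ, W = 32 * Λ / ε ^ 2 := ⟨_, rfl⟩
  have hW0 : 0 < W := by rw [hW]; positivity
  have hε'0 : 0 ≤ ε' := by rw [hε']; positivity
  have hε'sq : ε' ^ 2 * p = ε ^ 2 := by
    rw [hε', mul_pow, Real.sq_sqrt (by positivity), hp]; field_simp
  have hε'1 : ε' ≤ 1 := by
    have : ε ^ 2 ≤ p := by rw [hp, le_div_iff₀ hn']; exact hs1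
    have : ε' ^ 2 * p ≤ 1 * p := by rw [hε'sq]; linarith
    have := le_of_mul_le_mul_right this hp0
    nlinarith
  obtain ⟨u, hu⟩ : ∃ u : ℝ, u = ε' / 4 := ⟨_, rfl⟩
  have hu0 : 0 ≤ u := by rw [hu]; positivity
  have hu1 : u < 1 := by rw [hu]; linarith
  have hε'u : ε' = 4 * u := by rw [hu]; ring
  have hkey : p * W * u ^ 2 = 2 * Λ := by
    have : p * W * u ^ 2 = (ε' ^ 2 * p) * W / 16 := by rw [hu]; ring
    rw [this, hε'sq, hW]; field_simp; norm_num
  have hRW : ∀ R : ℝ, R * ε ^ 2 / (32 * Λ) = R / W := by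
    intro R; rw [hW]; field_simp
  simp only [hRW] at hwA hwC hwπ
  have h1u : 0 ≤ 1 - u := by linarith
  obtain ⟨x, hx⟩ : ∃ x : Fin n → Fin k → ℝ, x = fun t j => (1 - u) * xs t j := ⟨_, rfl⟩
  have hsimp : ∀ t, inFullSimplex (x t) := by
    intro t
    rw [hx]
    refine ⟨fun j => mul_nonneg h1u ((hxs.1 t).1 j), ?_⟩
    rw [← Finset.mul_sum]
    have h1 := (hxs.1 t).2
    have h2 : 0 ≤ ∑ j, xs t j := Finset.sum_nonneg fun j _ => (hxs.1 t).1 j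
    nlinarith
  have hscale : ∀ w : Fin n → Fin k → ℝ,
      ∑ t, ∑ j, w t j * x t j = (1 - u) * ∑ t, ∑ j, w t j * xs t j := by
    intro w
    simp only [hx, Finset.mul_sum]
    refine Finset.sum_congr rfl fun t _ => Finset.sum_congr rfl fun j _ => by ring
  have hopt0 : 0 ≤ L.opt := by
    rw [← hval]
    exact Finset.sum_nonneg fun t _ => simplex_sum_nonneg _ _ (hπ0 t) (hxs.1 t)
  have hA := fun i => aux_up (s := s) hn (fun t => ∑ j, L.A t i j * x t j) p u W (L.b i) Λ hp hp0 hW0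
    (hb0 i) hu0 hu1 hkey (fun t => simplex_sum_nonneg _ _ (hA0 t i) (hsimp t))
    (fun t => simplex_sum_le _ _ _ (div_nonneg (hb0 i).le hW0.le) (hwA t i) (hsimp t))
    (by rw [hscale fun t j => L.A t i j]; exact mul_le_mul_of_nonneg_left (hxs.2.1 i) h1u)
    (fun I => p * L.b i < ∑ t ∈ I, ∑ j, L.A t i j * x t j) (fun I h => h.le)
  have hC := fun i => aux_low (s := s) hn (fun t => ∑ j, L.C t i j * x t j) p u (4 * u) W (L.d i) Λ
    hp hp0 hW0 (hd0 i) hu0 hu1 (by linarith)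
    (by
      have : p * W * (4 * u - u) ^ 2 = 9 * (p * W * u ^ 2) := by ring
      rw [this, hkey]; linarith) (fun t => simplex_sum_nonneg _ _ (hC0 t i) (hsimp t))
    (fun t => simplex_sum_le _ _ _ (div_nonneg (hd0 i).le hW0.le) (hwC t i) (hsimp t))
    (by rw [hscale fun t j => L.C t i j]; exact mul_le_mul_of_nonneg_left (hxs.2.2 i) h1u)
    (fun I => ∑ t ∈ I, ∑ j, L.C t i j * x t j < (1 - 4 * u) * (p * L.d i)) (fun I h => h.le)
  have hV : ((((Finset.univ : Finset (Fin n)).powersetCard s).filter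
      fun I => L.restValue I x < (1 - 2 * ρ * u) * (p * L.opt)).card : ℝ)
      ≤ (n.choose s : ℝ) * Real.exp (-Λ) := by
    rcases hopt0.eq_or_lt with h0 | h0
    · rw [Finset.filter_false_of_mem]
      · simp only [Finset.card_empty, Nat.cast_zero]; positivity
      · intro I _
        rw [← h0, not_lt, mul_zero, mul_zero]
        exact Finset.sum_nonneg fun t _ => simplex_sum_nonneg _ _ (hπ0 t) (hsimp t)
    · have hρ0 : 0 < ρ := by linarith
      have hWρ : ρ * L.opt / W = L.opt / (W / ρ) := by field_simp
      refine aux_low (s := s) hn (fun t => ∑ j, L.pi t j * x t j) p u (2 * ρ * u) (W / ρ) L.opt Λ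
        hp hp0 (by positivity) h0 hu0 hu1 (by nlinarith) ?_
        (fun t => simplex_sum_nonneg _ _ (hπ0 t) (hsimp t))
        (fun t => simplex_sum_le _ _ _ (by positivity) (by rw [← hWρ]; exact hwπ t) (hsimp t))
        (by rw [hscale fun t j => L.pi t j, ← hval]; exact le_rfl)
        _ (fun I h => h.le)
      have h1 : p * (W / ρ) * (2 * ρ * u - u) ^ 2 = (p * W * u ^ 2) * ((2 * ρ - 1) ^ 2 / ρ) := by
        field_simp
      rw [h1, hkey]
      have h2 : 1 ≤ (2 * ρ - 1) ^ 2 / ρ := by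
        rw [le_div_iff₀ hρ0]; nlinarith
      nlinarith
  refine frac_bound n s hs2 _ (4 * δ) ?_
  have hsub : (((Finset.univ : Finset (Fin n)).powersetCard s).filter fun I =>
      ¬ ∃ x, L.RestFeasible I (1 - ε') x ∧
        (1 - ρ * ε' / 2) * ((s : ℝ) / n) * L.opt ≤ L.restValue I x) ⊆
      ((Finset.univ.biUnion fun i => ((Finset.univ : Finset (Fin n)).powersetCard s).filter
        fun I => p * L.b i < ∑ t ∈ I, ∑ j, L.A t i j * x t j) ∪
      (Finset.univ.biUnion fun i => ((Finset.univ : Finset (Fin n)).powersetCard s).filter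
        fun I => ∑ t ∈ I, ∑ j, L.C t i j * x t j < (1 - 4 * u) * (p * L.d i))) ∪
      ((Finset.univ : Finset (Fin n)).powersetCard s).filter
        fun I => L.restValue I x < (1 - 2 * ρ * u) * (p * L.opt) := by
    intro I hI
    rw [Finset.mem_filter] at hI
    obtain ⟨hI, hbad⟩ := hI
    have hcard : I.card = s := (Finset.mem_powersetCard.1 hI).2
    by_contra hcon
    simp only [Finset.mem_union, Finset.mem_biUnion, Finset.mem_filter, Finset.mem_univ, true_and,
      hI, not_or, not_exists, not_lt] at hcon
    obtain ⟨⟨h1, h2⟩, h3⟩ := hcon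
    refine hbad ⟨x, ⟨hsimp, fun i => ?_, fun i => ?_⟩, ?_⟩
    · rw [hcard, ← hp]; exact h1 i
    · rw [hcard, ← hp, hε'u]; exact h2 i
    · rw [← hp, hε'u]
      refine le_trans (le_of_eq ?_) h3
      ring
  have hcard : ((((Finset.univ : Finset (Fin n)).powersetCard s).filter fun I =>
      ¬ ∃ x, L.RestFeasible I (1 - ε') x ∧
        (1 - ρ * ε' / 2) * ((s : ℝ) / n) * L.opt ≤ L.restValue I x).card : ℝ) ≤
      (∑ i : Fin mp, (n.choose s : ℝ) * Real.exp (-Λ) + ∑ i : Fin mc, (n.choose s : ℝ) * Real.exp (-Λ))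
        + (n.choose s : ℝ) * Real.exp (-Λ) := by
    refine le_trans (Nat.cast_le.2 ((Finset.card_le_card hsub).trans (Finset.card_union_le _ _))) ?_
    rw [Nat.cast_add]
    refine add_le_add (le_trans (Nat.cast_le.2 (Finset.card_union_le _ _)) ?_) hV
    rw [Nat.cast_add]
    refine add_le_add (le_trans (Nat.cast_le.2 Finset.card_biUnion_le) ?_)
      (le_trans (Nat.cast_le.2 Finset.card_biUnion_le) ?_)
    · rw [Nat.cast_sum]
      exact Finset.sum_le_sum fun i _ => hA i
    · rw [Nat.cast_sum]
      exact Finset.sum_le_sum fun i _ => hC i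
  refine hcard.trans ?_
  simp only [Finset.sum_const, Finset.card_univ, Fintype.card_fin, nsmul_eq_mul]
  have h5 : (mp:ℝ) * ((n.choose s : ℝ) * Real.exp (-Λ)) + mc * ((n.choose s : ℝ) * Real.exp (-Λ))
      + (n.choose s : ℝ) * Real.exp (-Λ) = (n.choose s : ℝ) * ((m + 1) * (δ / m)) := by
    rw [hexp, hmdef]; ring
  rw [h5]
  refine mul_le_mul_of_nonneg_left ?_ (Nat.cast_nonneg _)
  rw [← mul_div_assoc, div_le_iff₀ (by linarith)]
  nlinarith

end
end
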